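/- Let p ≥ 3 be a prime and let N be the supersingular K3 lattice of characteristic p and Artin invariant σ (1 ≤ σ ≤ 10). Let 𝔐 be the set of primitive sublattices M ⊆ N with M isometric to Γ(2) such that no vector x ∈ N with ⟨x,x⟩ = −2 is orthogonal to M. Then the action of O(N) on 𝔐 has only finitely many orbits. -/

import Mathlib

open Matrix

noncomputable section

/-- The bilinear form on `ℤ^n` given by a Gram matrix `G`. -/
def bilin {n : ℕ} (G : Matrix (Fin n) (Fin n) ℤ) (x y : Fin n → ℤ) : ℤ :=
  x ⬝ᵥ G.mulVec y

/-- The `ℚ`-bilinear extension of the form given by `G`. -/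
def bilinQ {n : ℕ} (G : Matrix (Fin n) (Fin n) ℤ) (x y : Fin n → ℚ) : ℚ :=
  x ⬝ᵥ (G.map (Int.cast : ℤ → ℚ)).mulVec y

/-- A Gram matrix of the even unimodular lattice `Γ = U ⊕ E8(-1)` of signature `(1,9)`. -/
def GammaGram : Matrix (Fin 10) (Fin 10) ℤ :=
  !![0,1,0,0,0,0,0,0,0,0;
     1,0,0,0,0,0,0,0,0,0;
     0,0,-2,1,0,0,0,0,0,0;
     0,0,1,-2,1,0,0,0,0,0;
     0,0,0,1,-2,1,0,0,0,0;
     0,0,0,0,1,-2,1,0,0,0;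
     0,0,0,0,0,1,-2,1,0,1;
     0,0,0,0,0,0,1,-2,1,0;
     0,0,0,0,0,0,0,1,-2,0;
     0,0,0,0,0,0,1,0,0,-2]

/-- A Gram matrix of `Γ(2)`. -/
def GammaTwoGram : Matrix (Fin 10) (Fin 10) ℤ := (2 : ℤ) • GammaGram

/-- `G` is a Gram matrix of the supersingular K3 lattice of characteristic `p` and Artin
invariant `σ`: an even lattice of rank 22 and signature `(1,21)` which is `p`-elementary
with discriminant `-p^(2σ)`. -/
def IsSSK3Gram (p σ : ℕ) (G : Matrix (Fin 22) (Fin 22) ℤ) : Prop :=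
  G.IsSymm ∧
  (∀ x : Fin 22 → ℤ, 2 ∣ bilin G x x) ∧
  G.det = -((p : ℤ) ^ (2 * σ)) ∧
  (∀ v : Fin 22 → ℤ, ∃ w : Fin 22 → ℤ, G.mulVec w = (p : ℤ) • v) ∧
  (∃ S : Matrix (Fin 22) (Fin 22) ℝ, IsUnit S.det ∧
    Sᵀ * G.map (Int.cast : ℤ → ℝ) * S =
      Matrix.diagonal (fun i => if i = 0 then (1 : ℝ) else -1))

/-- A submodule `M` is a primitive sublattice if the quotient by it is torsion-free. -/
def IsPrimitiveSub {n : ℕ} (M : Submodule ℤ (Fin n → ℤ)) : Prop :=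
  ∀ (c : ℤ) (x : Fin n → ℤ), c ≠ 0 → c • x ∈ M → x ∈ M

/-- `P` is (the matrix of) an isometry of the lattice with Gram matrix `G`. -/
def IsIsom {n : ℕ} (G P : Matrix (Fin n) (Fin n) ℤ) : Prop :=
  IsUnit P.det ∧ Pᵀ * G * P = G

/-- The set `𝔐` of primitive sublattices of `N` isometric to `Γ(2)` such that no vector of
square `-2` is orthogonal to them. -/
def EnriquesSet (G : Matrix (Fin 22) (Fin 22) ℤ) : Set (Submodule ℤ (Fin 22 → ℤ)) :=
  {M | IsPrimitiveSub M ∧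
    (∃ e : Matrix (Fin 22) (Fin 10) ℤ,
        LinearMap.range e.mulVecLin = M ∧ eᵀ * G * e = GammaTwoGram) ∧
    ∀ x : Fin 22 → ℤ, bilin G x x = -2 → ¬ (∀ m ∈ M, bilin G x m = 0)}

/-- Positivity of the quadratic form `x ↦ xᵀ A x` on nonzero integral vectors. -/
def IsPosForm {ι : Type*} [Fintype ι] (A : Matrix ι ι ℤ) : Prop :=
  ∀ x : ι → ℤ, x ≠ 0 → 0 < x ⬝ᵥ A *ᵥ x

/-- Every positive definite integral form `A` indexed by `ι` has an equivalent form whose diagonal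
entries have product at most `c * det A`. -/
def HasReductionConstant (ι : Type*) [Fintype ι] [DecidableEq ι] (c : ℤ) : Prop :=
  ∀ A : Matrix ι ι ℤ, A.IsSymm → IsPosForm A →
    ∃ U : Matrix ι ι ℤ, IsUnit U.det ∧ ∏ i, (Uᵀ * A * U) i i ≤ c * A.det

theorem Matrix.dotProduct_transpose_mul_mul_mulVec {ι κ R : Type*} [Fintype ι] [Fintype κ]
    [CommRing R] (A : Matrix ι ι R) (U : Matrix ι κ R) (x y : κ → R) :
    x ⬝ᵥ (Uᵀ * A * U) *ᵥ y = (U *ᵥ x) ⬝ᵥ A *ᵥ (U *ᵥ y) := by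
  rw [← mulVec_mulVec, ← mulVec_mulVec, dotProduct_mulVec, vecMul_transpose]

theorem IsPosForm.conj {ι κ : Type*} [Fintype ι] [Fintype κ] {A : Matrix ι ι ℤ} (hA : IsPosForm A)
    {U : Matrix ι κ ℤ} (hU : ∀ x, U *ᵥ x = 0 → x = 0) : IsPosForm (Uᵀ * A * U) := by
  intro x hx
  rw [dotProduct_transpose_mul_mul_mulVec]
  exact hA _ fun h => hx (hU x h)

theorem Matrix.IsSymm.conj {ι κ : Type*} [Fintype ι] {A : Matrix ι ι ℤ}
    (hA : A.IsSymm) (U : Matrix ι κ ℤ) : (Uᵀ * A * U).IsSymm := by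
  simp [Matrix.IsSymm, Matrix.mul_assoc, hA.eq]

theorem IsPosForm.diag_pos {ι : Type*} [Fintype ι] [DecidableEq ι] {A : Matrix ι ι ℤ}
    (hA : IsPosForm A) (i : ι) : 0 < A i i := by
  have := hA (Pi.single i 1) (by simp)
  simpa using this

theorem mulVec_eq_zero_of_isUnit_det {ι : Type*} [Fintype ι] [DecidableEq ι]
    {U : Matrix ι ι ℤ} (hU : IsUnit U.det) (x : ι → ℤ) (h : U *ᵥ x = 0) : x = 0 :=
  eq_zero_of_mulVec_eq_zero hU.ne_zero h

theorem det_conj_of_isUnit_det {ι : Type*} [Fintype ι] [DecidableEq ι]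
    {U : Matrix ι ι ℤ} (hU : IsUnit U.det) (A : Matrix ι ι ℤ) : (Uᵀ * A * U).det = A.det := by
  have h : U.det * U.det = 1 := Int.isUnit_mul_self hU
  rw [det_mul, det_mul, det_transpose]
  linear_combination A.det * h

theorem exists_two_mul_abs_mul_add_le {m : ℤ} (hm : 0 < m) (s : ℤ) :
    ∃ t : ℤ, 2 * |m * t + s| ≤ m := by
  refine ⟨-((2 * s + m) / (2 * m)), ?_⟩
  have h1 := Int.emod_add_mul_ediv (2 * s + m) (2 * m)
  have h2 := Int.emod_nonneg (2 * s + m) (show 2 * m ≠ 0 by positivity)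
  have h3 := Int.emod_lt_of_pos (2 * s + m) (show 0 < 2 * m by positivity)
  set q := (2 * s + m) / (2 * m)
  have : 2 * |m * -q + s| = |2 * (m * -q + s)| := by simp [abs_mul]
  rw [this, abs_le]
  constructor <;> nlinarith

theorem exists_prod_diag_le_of_minimal {ι : Type*} [Fintype ι] [DecidableEq ι] {c : ℤ}
    (hc : HasReductionConstant ι c) {A : Matrix (Unit ⊕ ι) (Unit ⊕ ι) ℤ} (hA : A.IsSymm)
    (hpos : IsPosForm A)
    (hmin : ∀ V : Matrix (Unit ⊕ ι) (Unit ⊕ ι) ℤ, IsUnit V.det →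
      A (.inl ()) (.inl ()) ≤ (Vᵀ * A * V) (.inl ()) (.inl ())) :
    ∃ U : Matrix (Unit ⊕ ι) (Unit ⊕ ι) ℤ, IsUnit U.det ∧
      ∏ i, (Uᵀ * A * U) i i ≤ 2 ^ Fintype.card ι * c * A.det := by
  obtain ⟨m, hm⟩ : ∃ m, m = A (.inl ()) (.inl ()) := ⟨_, rfl⟩
  obtain ⟨a, ha⟩ : ∃ a, a = A.toBlocks₁₂ := ⟨_, rfl⟩
  obtain ⟨B, hB⟩ : ∃ B, B = A.toBlocks₂₂ := ⟨_, rfl⟩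
  have hblocks : A = fromBlocks (m • 1) a aᵀ B := by
    rw [← fromBlocks_toBlocks A, ha, hB]
    congr 1
    · ext i j; simp [hm, toBlocks₁₁]
    · ext i j; exact hA.apply _ _
  have hBs : B.IsSymm := by
    ext i j; rw [hB]; exact hA.apply _ _
  have hm0 : 0 < m := hm ▸ hpos.diag_pos _
  -- the scaled projection of the form to the orthogonal complement of the first basis vector
  obtain ⟨Q, hQ⟩ : ∃ Q, Q = m • B - aᵀ * a := ⟨_, rfl⟩
  have hQs : Q.IsSymm := by
    rw [hQ]
    simp [-zsmul_eq_mul, Matrix.IsSymm, hBs.eq]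
  have hQconj : (fromBlocks 1 0 (-aᵀ) (m • 1) : Matrix (Unit ⊕ ι) (Unit ⊕ ι) ℤ) * A =
      fromBlocks (m • 1) a 0 Q := by
    rw [hblocks, fromBlocks_multiply, hQ]
    simp only [Matrix.smul_mul, Matrix.mul_smul, Matrix.one_mul, Matrix.mul_one,
      Matrix.zero_mul, add_zero, Matrix.neg_mul, smul_neg, neg_add_eq_sub, sub_self]
  have hdet : m * Q.det = m ^ Fintype.card ι * A.det := by
    have := congrArg Matrix.det hQconj
    rw [det_mul, det_fromBlocks_zero₁₂, det_fromBlocks_zero₂₁] at this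
    simp only [det_one, det_smul, mul_one, one_mul, Fintype.card_unit, pow_one] at this
    exact this.symm
  have hQpos : IsPosForm Q := by
    intro x hx
    let W : Matrix (Unit ⊕ ι) ι ℤ := fromRows (-a) (m • 1)
    have hW : Wᵀ * A * W = m • Q := by
      rw [hblocks, hQ]
      simp only [W, transpose_fromRows, fromCols_mul_fromBlocks, fromCols_mul_fromRows]
      simp only [Matrix.smul_mul, Matrix.mul_smul, Matrix.one_mul, Matrix.mul_one, zero_add,
        transpose_neg, transpose_smul, transpose_one, Matrix.neg_mul, Matrix.mul_neg, smul_neg, neg_add_eq_sub,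
        sub_self, Matrix.zero_mul, neg_zero]
    have hWi : ∀ x, W *ᵥ x = 0 → x = 0 := by
      intro x h
      funext i
      have := congrFun h (.inr i)
      simpa [W, fromRows_mulVec, smul_mulVec, hm0.ne'] using this
    have := hpos.conj hWi x hx
    rw [hW, smul_mulVec, dotProduct_smul, smul_eq_mul] at this
    exact pos_of_mul_pos_right this hm0.le
  obtain ⟨U', hU', hprod⟩ := hc Q hQs hQpos
  choose t ht using fun i => exists_two_mul_abs_mul_add_le hm0 ((a * U') () i)
  let T : Matrix Unit ι ℤ := of fun _ i => t i
  let U : Matrix (Unit ⊕ ι) (Unit ⊕ ι) ℤ := fromBlocks 1 T 0 U'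
  have hU : IsUnit U.det := by simpa [U, det_fromBlocks_zero₂₁] using hU'
  let w : Matrix Unit ι ℤ := m • T + a * U'
  have hconj : Uᵀ * A * U = fromBlocks (m • 1) w wᵀ
      ((m • Tᵀ + U'ᵀ * aᵀ) * T + (Tᵀ * a + U'ᵀ * B) * U') := by
    rw [hblocks]
    simp only [U, fromBlocks_transpose, fromBlocks_multiply]
    simp only [Matrix.smul_mul, Matrix.mul_smul, Matrix.one_mul, Matrix.mul_one,
      Matrix.zero_mul, Matrix.mul_zero, add_zero, w, transpose_one,
      transpose_zero, transpose_add, transpose_smul, transpose_mul]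
  have hlow : m • ((m • Tᵀ + U'ᵀ * aᵀ) * T + (Tᵀ * a + U'ᵀ * B) * U') =
      wᵀ * w + U'ᵀ * Q * U' := by
    simp only [w, hQ, transpose_add, transpose_smul, transpose_mul, Matrix.mul_add, Matrix.add_mul,
      Matrix.mul_sub, Matrix.sub_mul, Matrix.smul_mul, Matrix.mul_smul,
      Matrix.mul_assoc, smul_add]
    abel
  have hdiag : ∀ i, m * (Uᵀ * A * U) (.inr i) (.inr i) ≤ 2 * (U'ᵀ * Q * U') i i := by
    intro i
    have h1 := congrFun (congrFun hlow i) i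
    have h2 : (Uᵀ * A * U) (.inr i) (.inr i) =
      ((m • Tᵀ + U'ᵀ * aᵀ) * T + (Tᵀ * a + U'ᵀ * B) * U') i i := by rw [hconj]; rfl
    rw [Matrix.smul_apply, ← h2, Matrix.add_apply, smul_eq_mul] at h1
    have h3 : (wᵀ * w) i i = w () i ^ 2 := by simp [Matrix.mul_apply, sq]
    have h4 : 2 * |w () i| ≤ m := by simpa [w, T] using ht i
    have h5 : m ≤ (Uᵀ * A * U) (.inr i) (.inr i) := by
      let π := Equiv.swap (Sum.inl () : Unit ⊕ ι) (.inr i)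
      have hV : IsUnit (U.submatrix id π).det := by
        rw [det_permute']
        exact ((Equiv.Perm.sign π).isUnit.map (Int.castRingHom ℤ)).mul hU
      have := hmin _ hV
      rw [← hm] at this
      refine this.trans_eq ?_
      rw [← Equiv.swap_apply_left (Sum.inl () : Unit ⊕ ι) (.inr i)]
      rfl
    have h6 : 4 * w () i ^ 2 ≤ m ^ 2 := by
      rw [← sq_abs (w () i)]
      nlinarith [abs_nonneg (w () i)]
    have h7 := (hQpos.conj (mulVec_eq_zero_of_isUnit_det hU')).diag_pos i
    nlinarith
  have hprod' : m ^ Fintype.card ι * ∏ i, (Uᵀ * A * U) (.inr i) (.inr i) ≤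
      2 ^ Fintype.card ι * (c * Q.det) := by
    calc _ = ∏ i, m * (Uᵀ * A * U) (.inr i) (.inr i) := by
          simp [Finset.prod_mul_distrib]
      _ ≤ ∏ i, 2 * (U'ᵀ * Q * U') i i := by
          refine Finset.prod_le_prod (fun i _ => ?_) fun i _ => hdiag i
          exact (mul_pos hm0 ((hpos.conj (mulVec_eq_zero_of_isUnit_det hU)).diag_pos _)).le
      _ = 2 ^ Fintype.card ι * ∏ i, (U'ᵀ * Q * U') i i := by
          simp [Finset.prod_mul_distrib]
      _ ≤ _ := by gcongr
  refine ⟨U, hU, ?_⟩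
  have h00 : (Uᵀ * A * U) (.inl ()) (.inl ()) = m := by
    rw [hconj, fromBlocks_apply₁₁, Matrix.smul_apply, one_apply_eq, smul_eq_mul, mul_one]
  rw [Fintype.prod_sum_type, Fintype.prod_unique, show (default : Unit) = () from rfl, h00]
  refine le_of_mul_le_mul_left ?_ (pow_pos hm0 (Fintype.card ι))
  calc _ = m * (m ^ Fintype.card ι * ∏ i, (Uᵀ * A * U) (.inr i) (.inr i)) := by ring
    _ ≤ m * (2 ^ Fintype.card ι * (c * Q.det)) := by gcongr
    _ = 2 ^ Fintype.card ι * c * (m * Q.det) := by ring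
    _ = _ := by rw [hdet]; ring

theorem HasReductionConstant.sum_unit {ι : Type*} [Fintype ι] [DecidableEq ι] {c : ℤ}
    (hc : HasReductionConstant ι c) :
    HasReductionConstant (Unit ⊕ ι) (2 ^ Fintype.card ι * c) := by
  intro A hA hpos
  obtain ⟨U₀, hU₀, hmin⟩ := (measure fun U : Matrix (Unit ⊕ ι) (Unit ⊕ ι) ℤ =>
    ((Uᵀ * A * U) (.inl ()) (.inl ())).toNat).wf.has_min {U | IsUnit U.det} ⟨1, by simp⟩
  obtain ⟨U₁, hU₁, h⟩ := exists_prod_diag_le_of_minimal hc (hA.conj U₀)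
    (hpos.conj (mulVec_eq_zero_of_isUnit_det hU₀)) (by
      intro V hV
      have hUV : IsUnit (U₀ * V).det := by rw [det_mul]; exact hU₀.mul hV
      have h1 := hmin _ hUV
      have h2 := (hpos.conj (mulVec_eq_zero_of_isUnit_det hUV)).diag_pos (.inl ())
      have h3 : Vᵀ * (U₀ᵀ * A * U₀) * V = (U₀ * V)ᵀ * A * (U₀ * V) := by
        simp [Matrix.mul_assoc]
      rw [h3]
      simp only [InvImage, WellFoundedRelation.rel] at h1
      change ¬ (_ < _) at h1
      omega)
  refine ⟨U₀ * U₁, by rw [det_mul]; exact hU₀.mul hU₁, ?_⟩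
  rw [det_conj_of_isUnit_det hU₀] at h
  simpa [Matrix.mul_assoc] using h

theorem HasReductionConstant.congr {ι κ : Type*} [Fintype ι] [DecidableEq ι] [Fintype κ]
    [DecidableEq κ] {c : ℤ} (e : κ ≃ ι) (hc : HasReductionConstant ι c) :
    HasReductionConstant κ c := by
  intro A hA hpos
  obtain ⟨U, hU, h⟩ := hc (A.submatrix e.symm e.symm) (hA.submatrix _) (by
    intro x hx
    have h1 : x ∘ e ≠ 0 := fun h => hx (by
      funext i; simpa using congrFun h (e.symm i))
    have h2 := hpos _ h1
    rwa [submatrix_mulVec_equiv, dotProduct_comp_equiv_symm])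
  refine ⟨U.submatrix e e, by rwa [det_submatrix_equiv_self], ?_⟩
  rw [det_submatrix_equiv_self] at h
  refine le_trans (le_of_eq ?_) h
  rw [← Equiv.prod_comp e]
  have hAe : A = (A.submatrix e.symm e.symm).submatrix e e := by simp
  rw [hAe, transpose_submatrix, submatrix_mul_equiv, submatrix_mul_equiv]
  simp

theorem exists_hasReductionConstant (n : ℕ) : ∃ c, HasReductionConstant (Fin n) c := by
  induction n with
  | zero => exact ⟨1, fun A _ _ => ⟨1, by simp, by simp⟩⟩
  | succ n ih =>
    obtain ⟨c, hc⟩ := ih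
    exact ⟨_, hc.sum_unit.congr
      ((finSumFinEquiv.symm.trans (Equiv.sumComm _ _)).trans
        (Equiv.sumCongr finOneEquiv (Equiv.refl _)))⟩

/-- Hermite: every positive definite integral form of bounded determinant is equivalent to
one with bounded entries. -/
theorem exists_bounded_equivalent_form (n : ℕ) (D : ℤ) :
    ∃ b : ℤ, ∀ A : Matrix (Fin n) (Fin n) ℤ, A.IsSymm → IsPosForm A → |A.det| ≤ D →
      ∃ U : Matrix (Fin n) (Fin n) ℤ, IsUnit U.det ∧ ∀ i j, |(Uᵀ * A * U) i j| ≤ b := by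
  obtain ⟨c, hc⟩ := exists_hasReductionConstant n
  refine ⟨|c| * D, fun A hA hpos hD => ?_⟩
  obtain ⟨U, hU, h⟩ := hc A hA hpos
  refine ⟨U, hU, ?_⟩
  have hs := hA.conj U
  have hp := hpos.conj (mulVec_eq_zero_of_isUnit_det hU)
  generalize Uᵀ * A * U = R at *
  have hdiag : ∀ i, R i i ≤ |c| * D := by
    intro i
    have h1 : R i i ≤ ∏ i, R i i := by
      rw [← Finset.mul_prod_erase _ _ (Finset.mem_univ i)]
      refine le_mul_of_one_le_right (hp.diag_pos i).le ?_
      exact Finset.prod_induction _ (1 ≤ ·) (fun a b ha hb => by nlinarith) le_rfl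
        fun i _ => hp.diag_pos i
    have h2 := hp.diag_pos i
    exact h1.trans (h.trans ((le_abs_self _).trans
      ((abs_mul c _).trans_le (mul_le_mul_of_nonneg_left hD (abs_nonneg c)))))
  intro i j
  rcases eq_or_ne i j with rfl | hij
  · rw [abs_of_pos (hp.diag_pos i)]
    exact hdiag i
  have hsym : R j i = R i j := hs.apply i j
  have hpm : ∀ s : ℤ, 0 < R i i + s * (2 * R i j) + s ^ 2 * R j j := by
    intro s
    have := hp (Pi.single i 1 + Pi.single j s) fun h => by
      simpa [hij] using congrFun h i
    simp only [mulVec_add, dotProduct_add, add_dotProduct, single_dotProduct, mulVec_single,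
      Pi.smul_apply, col_apply, MulOpposite.smul_eq_mul_unop, MulOpposite.unop_op, hsym] at this
    linarith
  have h1 := hpm 1
  have h2 := hpm (-1)
  have h3 := hdiag i
  have h4 := hdiag j
  rw [abs_le]
  constructor <;> linarith

theorem hyperbolic_orthogonal {n : ℕ} {a b : Fin (n + 1) → ℝ}
    (ha : ∑ i : Fin n, a i.succ ^ 2 < a 0 ^ 2) (hab : a 0 * b 0 = ∑ i : Fin n, a i.succ * b i.succ)
    (hb : ∑ i : Fin n, b i.succ ^ 2 ≤ b 0 ^ 2) : b = 0 := by
  have hcs := Finset.sum_mul_sq_le_sq_mul_sq Finset.univ (fun i : Fin n => a i.succ)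
    (fun i : Fin n => b i.succ)
  rw [← hab] at hcs
  have ha0 : 0 ≤ ∑ i : Fin n, a i.succ ^ 2 := Finset.sum_nonneg fun i _ => sq_nonneg _
  have hb0 : b 0 = 0 := by
    by_contra h
    have : 0 < b 0 ^ 2 := by positivity
    nlinarith
  have hsum : ∑ i : Fin n, b i.succ ^ 2 = 0 :=
    le_antisymm (by simpa [hb0] using hb) (Finset.sum_nonneg fun i _ => sq_nonneg _)
  rw [Finset.sum_eq_zero_iff_of_nonneg fun i _ => sq_nonneg _] at hsum
  funext i
  refine Fin.cases hb0 (fun i => ?_) i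
  simpa using hsum i (Finset.mem_univ i)

theorem dotProduct_hyperbolic_mulVec {n : ℕ} (a b : Fin (n + 1) → ℝ) :
    a ⬝ᵥ diagonal (fun i => if i = 0 then (1 : ℝ) else -1) *ᵥ b =
      a 0 * b 0 - ∑ i : Fin n, a i.succ * b i.succ := by
  simp [dotProduct, mulVec_diagonal, Fin.sum_univ_succ, sub_eq_add_neg]

/-- In a hyperbolic lattice the orthogonal complement of a vector of positive square is
negative definite. -/
theorem dotProduct_mulVec_self_neg {n : ℕ} {G : Matrix (Fin (n + 1)) (Fin (n + 1)) ℤ}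
    {S : Matrix (Fin (n + 1)) (Fin (n + 1)) ℝ} (hS : IsUnit S.det)
    (hSG : Sᵀ * G.map (Int.cast : ℤ → ℝ) * S =
      diagonal (fun i => if i = 0 then (1 : ℝ) else -1))
    {u x : Fin (n + 1) → ℤ} (hu : 0 < u ⬝ᵥ G *ᵥ u) (hux : u ⬝ᵥ G *ᵥ x = 0) (hx : x ≠ 0) :
    x ⬝ᵥ G *ᵥ x < 0 := by
  have hcoord : ∀ y : Fin (n + 1) → ℤ, ∃ a, S *ᵥ a = fun i => (y i : ℝ) := fun y =>
    ⟨S⁻¹ *ᵥ fun i => (y i : ℝ), by rw [mulVec_mulVec, mul_nonsing_inv _ hS, one_mulVec]⟩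
  have hform : ∀ y z : Fin (n + 1) → ℤ, ∀ a b, (S *ᵥ a = fun i => (y i : ℝ)) →
      (S *ᵥ b = fun i => (z i : ℝ)) →
      ((y ⬝ᵥ G *ᵥ z : ℤ) : ℝ) = a 0 * b 0 - ∑ i : Fin n, a i.succ * b i.succ := by
    intro y z a b ha hb
    rw [← dotProduct_hyperbolic_mulVec, ← hSG, dotProduct_transpose_mul_mul_mulVec, ha, hb]
    simp [dotProduct, mulVec]
  obtain ⟨a, ha⟩ := hcoord u
  obtain ⟨b, hb⟩ := hcoord x
  have h1 := hform _ _ _ _ ha ha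
  have h2 := hform _ _ _ _ ha hb
  have h3 := hform _ _ _ _ hb hb
  by_contra! h
  refine hx ?_
  have hu' : (0 : ℝ) < (u ⬝ᵥ G *ᵥ u : ℤ) := by exact_mod_cast hu
  have hx' : (0 : ℝ) ≤ (x ⬝ᵥ G *ᵥ x : ℤ) := by exact_mod_cast h
  rw [hux, Int.cast_zero] at h2
  simp only [← sq] at h1 h3
  have hb0 : b = 0 := hyperbolic_orthogonal (a := a) (by linarith) (by linarith) (by linarith)
  rw [hb0, mulVec_zero] at hb
  funext i
  have := congrFun hb i
  exact_mod_cast this.symm.trans (Pi.zero_apply i)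

/-- The inverse of `GammaGram`. -/
def GammaGramInv : Matrix (Fin 10) (Fin 10) ℤ :=
  !![0,1,0,0,0,0,0,0,0,0;
     1,0,0,0,0,0,0,0,0,0;
     0,0,-2,-3,-4,-5,-6,-4,-2,-3;
     0,0,-3,-6,-8,-10,-12,-8,-4,-6;
     0,0,-4,-8,-12,-15,-18,-12,-6,-9;
     0,0,-5,-10,-15,-20,-24,-16,-8,-12;
     0,0,-6,-12,-18,-24,-30,-20,-10,-15;
     0,0,-4,-8,-12,-16,-20,-14,-7,-10;
     0,0,-2,-4,-6,-8,-10,-7,-4,-5;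
     0,0,-3,-6,-9,-12,-15,-10,-5,-8]

theorem GammaGram_mul_inv : GammaGram * GammaGramInv = 1 := by
  decide +kernel

theorem GammaGramInv_mul : GammaGramInv * GammaGram = 1 :=
  mul_eq_one_comm.mp GammaGram_mul_inv

theorem isUnit_det_GammaGram : IsUnit GammaGram.det := by
  refine IsUnit.of_mul_eq_one GammaGramInv.det ?_
  rw [← det_mul, GammaGram_mul_inv, det_one]

theorem GammaTwoGram_mulVec_injective (y : Fin 10 → ℤ) (h : GammaTwoGram *ᵥ y = 0) : y = 0 := by
  have h1 : (2 : ℤ) • y = 0 := by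
    rw [← one_mulVec y, ← GammaGramInv_mul, ← mulVec_mulVec, ← mulVec_smul, ← smul_mulVec,
      ← GammaTwoGram, h, mulVec_zero]
  exact (smul_eq_zero.mp h1).resolve_left two_ne_zero

/-- The columns of `f` form a basis of the orthogonal complement of the columns of `e`. -/
def IsOrthogonalBasis {l m n : ℕ} (G : Matrix (Fin n) (Fin n) ℤ) (e : Matrix (Fin n) (Fin l) ℤ)
    (f : Matrix (Fin n) (Fin m) ℤ) : Prop :=
  eᵀ * G * f = 0 ∧ (∀ x, (eᵀ * G) *ᵥ x = 0 → ∃ z, f *ᵥ z = x) ∧ ∀ z, f *ᵥ z = 0 → z = 0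

theorem IsOrthogonalBasis.mul {l m n : ℕ} {G : Matrix (Fin n) (Fin n) ℤ}
    {e : Matrix (Fin n) (Fin l) ℤ} {f : Matrix (Fin n) (Fin m) ℤ} (h : IsOrthogonalBasis G e f)
    {U : Matrix (Fin m) (Fin m) ℤ} (hU : IsUnit U.det) : IsOrthogonalBasis G e (f * U) := by
  refine ⟨by rw [← Matrix.mul_assoc, h.1, Matrix.zero_mul], fun x hx => ?_, fun z hz => ?_⟩
  · obtain ⟨z, rfl⟩ := h.2.1 x hx
    refine ⟨U⁻¹ *ᵥ z, ?_⟩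
    rw [mulVec_mulVec, Matrix.mul_assoc, mul_nonsing_inv _ hU, Matrix.mul_one]
  · rw [← mulVec_mulVec] at hz
    exact mulVec_eq_zero_of_isUnit_det hU z (h.2.2 _ hz)

theorem transpose_mul_sub_eq_zero {G : Matrix (Fin 22) (Fin 22) ℤ} {e : Matrix (Fin 22) (Fin 10) ℤ}
    (he : eᵀ * G * e = GammaTwoGram) :
    eᵀ * G * ((2 : ℤ) • 1 - e * (GammaGramInv * (eᵀ * G))) = 0 := by
  rw [Matrix.mul_sub, ← Matrix.mul_assoc _ e, he, GammaTwoGram, Matrix.smul_mul,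
    ← Matrix.mul_assoc GammaGram, GammaGram_mul_inv, Matrix.one_mul, Matrix.mul_smul,
    Matrix.mul_one, sub_self]

theorem exists_isOrthogonalBasis {G : Matrix (Fin 22) (Fin 22) ℤ} {e : Matrix (Fin 22) (Fin 10) ℤ}
    (he : eᵀ * G * e = GammaTwoGram) :
    ∃ f : Matrix (Fin 22) (Fin 12) ℤ, IsOrthogonalBasis G e f := by
  let K := LinearMap.ker (eᵀ * G).mulVecLin
  let φ : ((Fin 10 → ℤ) × K) →ₗ[ℤ] (Fin 22 → ℤ) := e.mulVecLin.coprod K.subtype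
  have hφ : Function.Injective φ := by
    rw [injective_iff_map_eq_zero]
    rintro ⟨y, k, hk⟩ h
    replace h : e *ᵥ y + k = 0 := h
    replace hk : (eᵀ * G) *ᵥ k = 0 := hk
    have h1 := congrArg ((eᵀ * G) *ᵥ ·) h
    simp only [mulVec_add, mulVec_mulVec, he, hk, add_zero, mulVec_zero] at h1
    have hy := GammaTwoGram_mulVec_injective y h1
    subst hy
    simpa using h
  let ψ : (Fin 22 → ℤ) →ₗ[ℤ] ((Fin 10 → ℤ) × K) :=
    (GammaGramInv * (eᵀ * G)).mulVecLin.prod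
      (((2 : ℤ) • 1 - e * (GammaGramInv * (eᵀ * G))).mulVecLin.codRestrict K fun x => by
        rw [LinearMap.mem_ker, mulVecLin_apply, mulVecLin_apply, mulVec_mulVec,
          transpose_mul_sub_eq_zero he, zero_mulVec])
  have hψ : Function.Injective ψ := by
    rw [injective_iff_map_eq_zero]
    intro x h
    have h1 : (GammaGramInv * (eᵀ * G)) *ᵥ x = 0 := congrArg Prod.fst h
    have h2 : ((2 : ℤ) • 1 - e * (GammaGramInv * (eᵀ * G))) *ᵥ x = 0 :=
      congrArg Subtype.val (congrArg Prod.snd h)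
    rw [sub_mulVec, ← mulVec_mulVec, h1, mulVec_zero, sub_zero, smul_mulVec, one_mulVec] at h2
    exact (smul_eq_zero.mp h2).resolve_left two_ne_zero
  have hrank : Module.finrank ℤ K = 12 := by
    have h1 := LinearMap.finrank_le_finrank_of_injective hφ
    have h2 := LinearMap.finrank_le_finrank_of_injective hψ
    rw [Module.finrank_prod, Module.finrank_fin_fun, Module.finrank_fin_fun] at h1 h2
    omega
  let b := Module.finBasisOfFinrankEq ℤ K hrank
  have hb : ∀ z, (of fun i j => (b j : Fin 22 → ℤ) i) *ᵥ z = (b.equivFun.symm z : K) := by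
    intro z
    rw [Module.Basis.equivFun_symm_apply]
    ext i
    simp [mulVec, dotProduct, mul_comm]
  refine ⟨of fun i j => (b j : Fin 22 → ℤ) i, ?_, fun x hx => ?_, fun z hz => ?_⟩
  · ext i j
    have h : (eᵀ * G) *ᵥ (b j : Fin 22 → ℤ) = 0 := (b j).2
    exact congrFun h i
  · exact ⟨b.equivFun ⟨x, hx⟩, by rw [hb]; simp⟩
  · rw [hb] at hz
    exact b.equivFun.symm.map_eq_zero_iff.mp (Subtype.ext hz)

/-- The identification of the index set of `Γ(2)` and its complement with that of `N`. -/
def colEquiv : Fin 10 ⊕ Fin 12 ≃ Fin 22 := finSumFinEquiv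

/-- The concatenation of the columns of two matrices. -/
def joinCols (e : Matrix (Fin 22) (Fin 10) ℤ) (f : Matrix (Fin 22) (Fin 12) ℤ) :
    Matrix (Fin 22) (Fin 22) ℤ :=
  (fromCols e f).submatrix id colEquiv.symm

/-- The Gram matrix of the orthogonal sum of `Γ(2)` and the lattice with Gram matrix `R`. -/
def sumGram (R : Matrix (Fin 12) (Fin 12) ℤ) : Matrix (Fin 22) (Fin 22) ℤ :=
  (fromBlocks GammaTwoGram 0 0 R).submatrix colEquiv.symm colEquiv.symm

theorem joinCols_gram {G : Matrix (Fin 22) (Fin 22) ℤ} (hG : G.IsSymm)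
    {e : Matrix (Fin 22) (Fin 10) ℤ} (he : eᵀ * G * e = GammaTwoGram)
    {f : Matrix (Fin 22) (Fin 12) ℤ} (hf : IsOrthogonalBasis G e f) :
    (joinCols e f)ᵀ * G * joinCols e f = sumGram (fᵀ * G * f) := by
  have h : fᵀ * G * e = 0 := by
    have := congrArg transpose hf.1
    simpa [hG.eq, Matrix.mul_assoc] using this
  rw [joinCols, sumGram, ← he, ← h, ← hf.1, transpose_submatrix, transpose_fromCols]
  rw [← fromRows_mul_fromCols, ← fromRows_mul]
  rfl

theorem exists_joinCols_mul_eq_two {G : Matrix (Fin 22) (Fin 22) ℤ}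
    {e : Matrix (Fin 22) (Fin 10) ℤ} (he : eᵀ * G * e = GammaTwoGram)
    {f : Matrix (Fin 22) (Fin 12) ℤ} (hf : IsOrthogonalBasis G e f) :
    ∃ C, joinCols e f * C = (2 : ℤ) • 1 := by
  choose z hz using fun j => hf.2.1
    (((2 : ℤ) • 1 - e * (GammaGramInv * (eᵀ * G))).col j) (by
      ext i
      exact congrFun (congrFun (transpose_mul_sub_eq_zero he) i) j)
  refine ⟨(fromRows (GammaGramInv * (eᵀ * G)) (of fun i j => z j i)).submatrix
    colEquiv.symm id, ?_⟩
  rw [joinCols, submatrix_mul_equiv, fromCols_mul_fromRows, submatrix_id_id]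
  have h : f * (of fun i j => z j i) = (2 : ℤ) • 1 - e * (GammaGramInv * (eᵀ * G)) := by
    ext i j
    exact congrFun (hz j) i
  rw [h, add_sub_cancel]

theorem abs_det_complement_le {G : Matrix (Fin 22) (Fin 22) ℤ} (hG : G.IsSymm)
    {e : Matrix (Fin 22) (Fin 10) ℤ} (he : eᵀ * G * e = GammaTwoGram)
    {f : Matrix (Fin 22) (Fin 12) ℤ} (hf : IsOrthogonalBasis G e f) :
    |(fᵀ * G * f).det| ≤ (2 ^ 22) ^ 2 * |G.det| := by
  obtain ⟨C, hC⟩ := exists_joinCols_mul_eq_two he hf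
  have h1 := congrArg det (joinCols_gram hG he hf)
  rw [sumGram, det_submatrix_equiv_self, det_fromBlocks_zero₁₂, det_mul, det_mul, det_transpose,
    GammaTwoGram, det_smul] at h1
  replace h1 := congrArg abs h1
  simp only [abs_mul, Int.isUnit_iff_abs_eq.mp isUnit_det_GammaGram, mul_one, abs_pow] at h1
  have h2 : |(joinCols e f).det| ≤ 2 ^ 22 := by
    have := congrArg det hC
    rw [det_mul, det_smul, det_one, mul_one, Fintype.card_fin] at this
    exact Int.le_of_dvd (by norm_num) ((abs_dvd _ _).mpr ⟨_, this.symm⟩)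
  calc |(fᵀ * G * f).det| ≤ |(2 : ℤ)| ^ Fintype.card (Fin 10) * |(fᵀ * G * f).det| :=
        le_mul_of_one_le_left (abs_nonneg _) (one_le_pow₀ (by norm_num))
    _ = |(joinCols e f).det| ^ 2 * |G.det| := by rw [← h1]; ring
    _ ≤ _ := by gcongr

theorem isPosForm_neg_complement {G : Matrix (Fin 22) (Fin 22) ℤ}
    {S : Matrix (Fin 22) (Fin 22) ℝ} (hS : IsUnit S.det)
    (hSG : Sᵀ * G.map (Int.cast : ℤ → ℝ) * S =
      diagonal (fun i => if i = 0 then (1 : ℝ) else -1))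
    {e : Matrix (Fin 22) (Fin 10) ℤ} (he : eᵀ * G * e = GammaTwoGram)
    {f : Matrix (Fin 22) (Fin 12) ℤ} (hf : IsOrthogonalBasis G e f) :
    IsPosForm (-(fᵀ * G * f)) := by
  intro z hz
  let y : Fin 10 → ℤ := ![1, 1, 0, 0, 0, 0, 0, 0, 0, 0]
  rw [neg_mulVec, dotProduct_neg, dotProduct_transpose_mul_mul_mulVec, neg_pos]
  refine dotProduct_mulVec_self_neg hS hSG (u := e *ᵥ y) ?_ ?_ fun h => hz (hf.2.2 z h)
  · rw [← dotProduct_transpose_mul_mul_mulVec, he]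
    decide +kernel
  · rw [mulVec_mulVec, ← vecMul_transpose, ← dotProduct_mulVec, mulVec_mulVec,
      ← Matrix.mul_assoc, hf.1, zero_mulVec, dotProduct_zero]

theorem finite_setOf_abs_le (n : ℕ) (b : ℤ) :
    {R : Matrix (Fin n) (Fin n) ℤ | ∀ i j, |R i j| ≤ b}.Finite :=
  (Set.finite_Icc (fun _ _ => -b : Fin n → Fin n → ℤ) (fun _ _ => b)).subset fun _ h =>
    ⟨fun i j => (abs_le.mp (h i j)).1, fun i j => (abs_le.mp (h i j)).2⟩

/-- Every sublattice in the set is spanned by the first ten columns of a matrix whose Gram matrix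
belongs to a fixed finite set and whose columns span a sublattice containing `2N`. -/
theorem exists_finite_gram (p σ : ℕ) (G : Matrix (Fin 22) (Fin 22) ℤ) (hG : IsSSK3Gram p σ G) :
    ∃ T : Set (Matrix (Fin 22) (Fin 22) ℤ), T.Finite ∧ ∃ J : Matrix (Fin 22) (Fin 10) ℤ,
      ∀ M ∈ EnriquesSet G, ∃ E C : Matrix (Fin 22) (Fin 22) ℤ, E * C = (2 : ℤ) • 1 ∧
        Eᵀ * G * E ∈ T ∧ LinearMap.range (E * J).mulVecLin = M := by
  obtain ⟨hsymm, -, -, -, S, hS, hSG⟩ := hG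
  obtain ⟨b, hb⟩ := exists_bounded_equivalent_form 12 ((2 ^ 22) ^ 2 * |G.det|)
  refine ⟨sumGram '' {R | ∀ i j, |R i j| ≤ b}, (finite_setOf_abs_le 12 b).image _,
    (1 : Matrix (Fin 22) (Fin 22) ℤ).submatrix id (colEquiv ∘ Sum.inl), ?_⟩
  rintro M ⟨-, ⟨e, heM, he⟩, -⟩
  obtain ⟨f, hf⟩ := exists_isOrthogonalBasis he
  obtain ⟨U, hU, hUb⟩ := hb (-(fᵀ * G * f)) (hsymm.conj f).neg
    (isPosForm_neg_complement hS hSG he hf) (by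
      rw [det_neg, Fintype.card_fin, Even.neg_one_pow (by decide), one_mul]
      exact abs_det_complement_le hsymm he hf)
  have hfU := hf.mul hU
  obtain ⟨C, hC⟩ := exists_joinCols_mul_eq_two he hfU
  refine ⟨joinCols e (f * U), C, hC, ?_, ?_⟩
  · rw [joinCols_gram hsymm he hfU]
    refine ⟨_, fun i j => ?_, rfl⟩
    have := hUb i j
    rw [Matrix.mul_neg, Matrix.neg_mul, Matrix.neg_apply, abs_neg] at this
    simpa only [transpose_mul, Matrix.mul_assoc] using this
  · have hJ : joinCols e (f * U) *
        (1 : Matrix (Fin 22) (Fin 22) ℤ).submatrix id (colEquiv ∘ Sum.inl) = e := by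
      ext i j
      simp [joinCols, Matrix.mul_apply, one_apply]
    rw [hJ, heM]

theorem mul_left_cancel_of_det_ne_zero {ι κ R : Type*} [Fintype ι] [DecidableEq ι] [CommRing R]
    [IsDomain R] {A : Matrix ι ι R} (hA : A.det ≠ 0) {B C : Matrix ι κ R} (h : A * B = A * C) :
    B = C := by
  have h1 := congrArg (A.adjugate * ·) h
  simp only [← Matrix.mul_assoc, adjugate_mul, Matrix.smul_mul, Matrix.one_mul] at h1
  ext i j
  exact mul_left_cancel₀ hA (congrFun (congrFun h1 i) j)

/-- Two finite-index overlattices with the same Gram matrix and the same glue are isometric. -/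
theorem exists_isIsom_of_glue_eq {n : ℕ} {G E E' C C' : Matrix (Fin n) (Fin n) ℤ}
    (hdet : G.det ≠ 0) (hE : E * C = (2 : ℤ) • 1) (hE' : E' * C' = (2 : ℤ) • 1)
    (hgram : Eᵀ * G * E = E'ᵀ * G * E')
    (hglue : C.map (Int.cast : ℤ → ZMod 2) = C'.map (Int.cast : ℤ → ZMod 2)) :
    ∃ P, IsIsom G P ∧ P * E' = E := by
  have hcomm : ∀ {A B : Matrix (Fin n) (Fin n) ℤ}, A * B = (2 : ℤ) • 1 →
      A.det ≠ 0 ∧ B * A = (2 : ℤ) • 1 := by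
    intro A B h
    have hA : A.det ≠ 0 := fun h0 => by
      have := congrArg det h
      rw [det_mul, h0, zero_mul, det_smul, det_one, mul_one] at this
      exact pow_ne_zero _ two_ne_zero this.symm
    refine ⟨hA, mul_left_cancel_of_det_ne_zero hA ?_⟩
    rw [← Matrix.mul_assoc, h, Matrix.smul_mul, Matrix.mul_smul, Matrix.one_mul, Matrix.mul_one]
  obtain ⟨X, hX⟩ : ∃ X, C' = C + (2 : ℤ) • X := by
    have : ∀ i j, ∃ x, C' i j = C i j + 2 * x := fun i j => by
      have h := congrFun (congrFun hglue i) j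
      simp only [map_apply] at h
      obtain ⟨x, hx⟩ := (ZMod.intCast_eq_intCast_iff_dvd_sub _ _ 2).mp h
      exact ⟨x, by push_cast at hx; linarith⟩
    choose x hx using this
    exact ⟨of x, by ext i j; simpa using hx i j⟩
  have hP : E * C' = (2 : ℤ) • (1 + E * X) := by
    rw [hX, Matrix.mul_add, hE, Matrix.mul_smul, smul_add]
  have hPE : (1 + E * X) * E' = E := by
    have : (2 : ℤ) • ((1 + E * X) * E') = (2 : ℤ) • E := by
      rw [← Matrix.smul_mul, ← hP, Matrix.mul_assoc, (hcomm hE').2, Matrix.mul_smul,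
        Matrix.mul_one]
    exact smul_right_injective _ (two_ne_zero : (2 : ℤ) ≠ 0) this
  generalize 1 + E * X = P at hPE
  have hE'0 := (hcomm hE').1
  have hPG : Pᵀ * G * P = G := by
    rw [← hPE, transpose_mul] at hgram
    have h1 : E'ᵀ * ((Pᵀ * G * P) * E') = E'ᵀ * (G * E') := by
      simpa only [Matrix.mul_assoc] using hgram
    have h2 := mul_left_cancel_of_det_ne_zero (by rwa [det_transpose]) h1
    refine transpose_injective (mul_left_cancel_of_det_ne_zero (A := E'ᵀ)
      (by rwa [det_transpose]) ?_)
    rw [← transpose_mul, ← transpose_mul, h2]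
  refine ⟨P, ⟨?_, hPG⟩, hPE⟩
  have := congrArg det hPG
  rw [det_mul, det_mul, det_transpose] at this
  refine IsUnit.of_mul_eq_one P.det (mul_right_cancel₀ hdet ?_)
  linear_combination this

/-- The action of `O(N)` on the set `𝔐` has only finitely many orbits. -/
theorem finitely_many_orbits (p σ : ℕ) (hp : p.Prime) (hp3 : 3 ≤ p)
    (hσ1 : 1 ≤ σ) (hσ10 : σ ≤ 10)
    (G : Matrix (Fin 22) (Fin 22) ℤ) (hG : IsSSK3Gram p σ G) :
    ∃ F : Finset (Submodule ℤ (Fin 22 → ℤ)),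
      ∀ M ∈ EnriquesSet G, ∃ M' ∈ F, ∃ P : Matrix (Fin 22) (Fin 22) ℤ,
        IsIsom G P ∧ Submodule.map P.mulVecLin M = M' := by
  obtain ⟨T, hT, J, hJ⟩ := exists_finite_gram p σ G hG
  have hdet : G.det ≠ 0 := by
    rw [hG.2.2.1]
    exact neg_ne_zero.mpr (pow_ne_zero _ (by exact_mod_cast hp.ne_zero))
  choose! E C hEC hET hEM using hJ
  let δ : Submodule ℤ (Fin 22 → ℤ) →
      Matrix (Fin 22) (Fin 22) ℤ × Matrix (Fin 22) (Fin 22) (ZMod 2) :=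
    fun M => ((E M)ᵀ * G * E M, (C M).map Int.cast)
  have hfin : (δ '' EnriquesSet G).Finite :=
    (hT.prod Set.finite_univ).subset (by
      rintro _ ⟨M, hM, rfl⟩
      exact ⟨hET M hM, Set.mem_univ _⟩)
  obtain ⟨F, hF, hbij⟩ := Set.SurjOn.exists_bijOn_subset (Set.surjOn_image δ (EnriquesSet G))
  have hFfin : F.Finite := hbij.finite_iff_finite.mpr hfin
  refine ⟨hFfin.toFinset, fun M hM => ?_⟩
  obtain ⟨M', hM', hδ⟩ := hbij.surjOn (Set.mem_image_of_mem δ hM)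
  have hM'G := hF hM'
  obtain ⟨hgram, hglue⟩ := Prod.ext_iff.mp hδ
  obtain ⟨P, hP, hPE⟩ := exists_isIsom_of_glue_eq hdet (hEC M' hM'G) (hEC M hM) hgram hglue
  refine ⟨M', hFfin.mem_toFinset.mpr hM', P, hP, ?_⟩
  rw [← hEM M hM, ← hEM M' hM'G, ← LinearMap.range_comp, ← mulVecLin_mul, ← Matrix.mul_assoc, hPE]

end
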